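/- For all n×n complex matrices A and B, the squared Frobenius norm of the commutator satisfies ‖AB − BA‖² ≤ 2‖A‖²‖B‖², where ‖·‖ is the Frobenius (Hilbert–Schmidt) norm. -/

import Mathlib

open Matrix Complex BigOperators

/-- Squared Frobenius (Hilbert-Schmidt) norm: ‖X‖² = tr(X*X). -/
noncomputable def frobSq {n : ℕ} (X : Matrix (Fin n) (Fin n) ℂ) : ℝ :=
  (Matrix.trace (Xᴴ * X)).re

/-- Hilbert-Schmidt inner product ⟨X,Y⟩ = tr(X*Y). -/
noncomputable def hsInner {n : ℕ} (X Y : Matrix (Fin n) (Fin n) ℂ) : ℂ :=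
  Matrix.trace (Xᴴ * Y)

/-- f(A,B;q) = Re⟨[B,A],[B,A]_q⟩ where [X,Y]_q = XY − qYX. -/
noncomputable def fFun {n : ℕ} (A B : Matrix (Fin n) (Fin n) ℂ) (q : ℝ) : ℝ :=
  (hsInner (B * A - A * B) (B * A - (q : ℂ) • (A * B))).re

/-- r(A,B) = (1/2)(⟨[B,A],BA⟩ + ⟨[B,A*],BA*⟩). -/
noncomputable def rFun {n : ℕ} (A B : Matrix (Fin n) (Fin n) ℂ) : ℂ :=
  (1/2 : ℂ) * (hsInner (B * A - A * B) (B * A) + hsInner (B * Aᴴ - Aᴴ * B) (B * Aᴴ))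

/-- c(q) = ((1+q) + √(2(1+q²)))/2. -/
noncomputable def cq (q : ℝ) : ℝ := ((1 + q) + Real.sqrt (2 * (1 + q ^ 2))) / 2

theorem frobSq_eq_sum {n : ℕ} (X : Matrix (Fin n) (Fin n) ℂ) :
    frobSq X = ∑ i, ∑ j, ‖X i j‖ ^ 2 := by
  rw [Finset.sum_comm]
  simp [frobSq, Matrix.trace, Matrix.mul_apply, ← Complex.normSq_eq_norm_sq, Complex.normSq_apply]

theorem frobSq_nonneg {n : ℕ} (X : Matrix (Fin n) (Fin n) ℂ) : 0 ≤ frobSq X := by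
  rw [frobSq_eq_sum]; positivity

/-- Cauchy–Schwarz for the Hilbert–Schmidt pairing. -/
theorem norm_trace_mul_sq_le {n : ℕ} (X Y : Matrix (Fin n) (Fin n) ℂ) :
    ‖Matrix.trace (X * Y)‖ ^ 2 ≤ frobSq X * frobSq Y := by
  have hY : frobSq Y = ∑ p : Fin n × Fin n, ‖Y p.2 p.1‖ ^ 2 := by
    rw [frobSq_eq_sum, Finset.sum_comm, Fintype.sum_prod_type]
  have hX : frobSq X = ∑ p : Fin n × Fin n, ‖X p.1 p.2‖ ^ 2 := by
    rw [frobSq_eq_sum, Fintype.sum_prod_type]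
  have htr : Matrix.trace (X * Y) = ∑ p : Fin n × Fin n, X p.1 p.2 * Y p.2 p.1 := by
    simp [Matrix.trace, Matrix.mul_apply, Fintype.sum_prod_type]
  rw [hX, hY, htr]
  refine le_trans ?_ (Finset.sum_mul_sq_le_sq_mul_sq _ _ _)
  gcongr
  refine (norm_sum_le _ _).trans_eq ?_
  simp

/-- The variance of a real-valued function is at most half the sum of its squares. -/
theorem weighted_variance_le {ι : Type*} [Fintype ι] (p h : ι → ℝ) (hp : ∀ i, 0 ≤ p i) :
    (∑ i, p i) * ∑ i, p i * h i ^ 2 - (∑ i, p i * h i) ^ 2 ≤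
      (∑ i, p i) ^ 2 * (∑ i, h i ^ 2) / 2 := by
  classical
  rcases isEmpty_or_nonempty ι with _ | _
  · simp
  obtain ⟨a, ha⟩ := Finite.exists_min h
  obtain ⟨b, hb⟩ := Finite.exists_max h
  have hP : 0 ≤ ∑ i, p i := Finset.sum_nonneg fun i _ => hp i
  have hchord : ∑ i, p i * h i ^ 2 ≤
      (h a + h b) * ∑ i, p i * h i - h a * h b * ∑ i, p i := by
    rw [Finset.mul_sum, Finset.mul_sum, ← Finset.sum_sub_distrib]
    refine Finset.sum_le_sum fun i _ => ?_
    nlinarith [mul_nonneg (hp i) (mul_nonneg (sub_nonneg.2 (ha i)) (sub_nonneg.2 (hb i)))]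
  have hrange : (h b - h a) ^ 2 ≤ 2 * ∑ i, h i ^ 2 := by
    by_cases hab : a = b
    · rw [hab, sub_self, zero_pow two_ne_zero]
      positivity
    · have hle : ∑ i ∈ {a, b}, h i ^ 2 ≤ ∑ i, h i ^ 2 :=
        Finset.sum_le_sum_of_subset_of_nonneg (Finset.subset_univ _) fun i _ _ => sq_nonneg _
      rw [Finset.sum_pair hab] at hle
      nlinarith [sq_nonneg (h a + h b)]
  nlinarith [mul_le_mul_of_nonneg_left hchord hP,
    mul_le_mul_of_nonneg_left hrange (sq_nonneg (∑ i, p i)),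
    sq_nonneg (2 * ∑ i, p i * h i - (h a + h b) * ∑ i, p i)]

section

open scoped ComplexOrder

theorem posSemidef_conjTranspose_mul_self_add {n : ℕ} (A : Matrix (Fin n) (Fin n) ℂ) :
    (Aᴴ * A + A * Aᴴ).PosSemidef :=
  (Matrix.posSemidef_conjTranspose_mul_self A).add (Matrix.posSemidef_self_mul_conjTranspose A)

/-- The variance of a Hermitian matrix `H` with respect to a positive semidefinite weight `D`. -/
theorem variance_le_of_isHermitian {n : ℕ} {D H : Matrix (Fin n) (Fin n) ℂ}
    (hD : D.PosSemidef) (hH : H.IsHermitian) :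
    (Matrix.trace D).re * (Matrix.trace (D * (H * H))).re - (Matrix.trace (D * H)).re ^ 2 ≤
      (Matrix.trace D).re ^ 2 * frobSq H / 2 := by
  set U : Matrix (Fin n) (Fin n) ℂ := (hH.eigenvectorUnitary : Matrix (Fin n) (Fin n) ℂ)
  set Λ : Matrix (Fin n) (Fin n) ℂ :=
    Matrix.diagonal (fun i => (hH.eigenvalues i : ℂ)) with hΛ
  have hU : Uᴴ * U = 1 := Unitary.coe_star_mul_self hH.eigenvectorUnitary
  have hU' : U * Uᴴ = 1 := Unitary.coe_mul_star_self hH.eigenvectorUnitary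
  have hspec : H = U * Λ * Uᴴ := by
    have := hH.spectral_theorem
    rw [Unitary.conjStarAlgAut_apply] at this
    exact this
  have hsq : H * H = U * (Λ * Λ) * Uᴴ := by
    calc H * H = U * Λ * (Uᴴ * U) * Λ * Uᴴ := by rw [hspec]; simp only [Matrix.mul_assoc]
      _ = _ := by rw [hU]; simp only [Matrix.mul_assoc, Matrix.one_mul]
  have hpsd : (Uᴴ * D * U).PosSemidef := hD.conjTranspose_mul_mul_same U
  have hconj : ∀ M : Matrix (Fin n) (Fin n) ℂ,
      Matrix.trace (D * (U * M * Uᴴ)) = Matrix.trace (Uᴴ * D * U * M) := by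
    intro M
    rw [← Matrix.mul_assoc, Matrix.trace_mul_comm]
    simp only [Matrix.mul_assoc]
  have h0 : (Matrix.trace D).re = ∑ i, ((Uᴴ * D * U) i i).re := by
    have := hconj 1
    rw [Matrix.mul_one, Matrix.mul_one, hU', Matrix.mul_one] at this
    rw [this]
    simp [Matrix.trace]
  have h1 : (Matrix.trace (D * H)).re =
      ∑ i, ((Uᴴ * D * U) i i).re * hH.eigenvalues i := by
    rw [congrArg (D * ·) hspec, hconj]
    simp [Matrix.trace, hΛ, Matrix.mul_diagonal]
  have h2 : (Matrix.trace (D * (H * H))).re =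
      ∑ i, ((Uᴴ * D * U) i i).re * hH.eigenvalues i ^ 2 := by
    rw [hsq, hconj, hΛ, Matrix.diagonal_mul_diagonal]
    simp [Matrix.trace, Matrix.mul_diagonal, pow_two]
  have h3 : frobSq H = ∑ i, hH.eigenvalues i ^ 2 := by
    rw [frobSq, hH.eq, hsq, Matrix.trace_mul_comm, ← Matrix.mul_assoc, hU, Matrix.one_mul, hΛ,
      Matrix.diagonal_mul_diagonal]
    simp [Matrix.trace, pow_two]
  rw [h0, h1, h2, h3]
  exact weighted_variance_le _ _ fun i => (Complex.le_def.1 hpsd.diag_nonneg).1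

end

theorem frobSq_commutator_add_frobSq_anticommutator {n : ℕ} (A B : Matrix (Fin n) (Fin n) ℂ) :
    frobSq (A * B - B * A) + frobSq (Aᴴ * B + B * Aᴴ) =
      (Matrix.trace ((Aᴴ * A + A * Aᴴ) * (Bᴴ * B + B * Bᴴ))).re := by
  have rot : ∀ W X Y Z : Matrix (Fin n) (Fin n) ℂ,
      Matrix.trace (W * (X * (Y * Z))) = Matrix.trace (X * (Y * (Z * W))) := by
    intro W X Y Z
    rw [Matrix.trace_mul_comm]
    simp only [Matrix.mul_assoc]
  simp only [frobSq, Matrix.conjTranspose_sub, Matrix.conjTranspose_add,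
    Matrix.conjTranspose_mul, Matrix.conjTranspose_conjTranspose, Matrix.mul_add, Matrix.add_mul,
    Matrix.mul_sub, Matrix.sub_mul, Matrix.trace_add, Matrix.trace_sub, Matrix.mul_assoc,
    Complex.add_re, Complex.sub_re]
  rw [rot Bᴴ Aᴴ A B, rot Bᴴ A Aᴴ B, rot Aᴴ Bᴴ B A, rot Bᴴ B A Aᴴ, rot B A Aᴴ Bᴴ,
    rot A Bᴴ B Aᴴ, rot Bᴴ B Aᴴ A, rot B Aᴴ A Bᴴ, rot Bᴴ Aᴴ B A, rot Aᴴ Bᴴ A B, rot Bᴴ A B Aᴴ,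
    rot A Bᴴ Aᴴ B, rot Bᴴ Aᴴ B A]
  ring

theorem frobSq_commutator_le_variance {n : ℕ} (A B : Matrix (Fin n) (Fin n) ℂ) :
    frobSq A * frobSq (A * B - B * A) ≤
      frobSq A * (Matrix.trace ((Aᴴ * A + A * Aᴴ) * (Bᴴ * B + B * Bᴴ))).re -
        ‖Matrix.trace ((Aᴴ * A + A * Aᴴ) * B)‖ ^ 2 := by
  have hcs := norm_trace_mul_sq_le A (Aᴴ * B + B * Aᴴ)
  have htr : Matrix.trace (A * (Aᴴ * B + B * Aᴴ)) =
      Matrix.trace ((Aᴴ * A + A * Aᴴ) * B) := by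
    rw [Matrix.mul_add, Matrix.add_mul, Matrix.trace_add, Matrix.trace_add,
      ← Matrix.mul_assoc A B, Matrix.trace_mul_comm (A * B), ← Matrix.mul_assoc,
      ← Matrix.mul_assoc, add_comm]
  rw [htr] at hcs
  rw [← frobSq_commutator_add_frobSq_anticommutator]
  linarith

/-- Böttcher–Wenzel inequality. -/
theorem bw_inequality (n : ℕ) (A B : Matrix (Fin n) (Fin n) ℂ) :
    frobSq (A * B - B * A) ≤ 2 * frobSq A * frobSq B := by
  rcases (frobSq_nonneg A).eq_or_lt with hA | hA
  · have hzero : A = 0 := by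
      rw [eq_comm, frobSq_eq_sum, Finset.sum_eq_zero_iff_of_nonneg fun i _ => by positivity] at hA
      ext i j
      have := (Finset.sum_eq_zero_iff_of_nonneg fun j _ => by positivity).1
        (hA i (Finset.mem_univ i)) j (Finset.mem_univ j)
      simpa using this
    simp [hzero, frobSq]
  set D := Aᴴ * A + A * Aᴴ with hD
  have hDpos := posSemidef_conjTranspose_mul_self_add A
  rw [← hD] at hDpos
  have hDtr : (Matrix.trace D).re = 2 * frobSq A := by
    rw [hD, Matrix.trace_add, Matrix.trace_mul_comm A, Complex.add_re, frobSq]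
    ring
  obtain ⟨H, K, hH, hK, rfl⟩ : ∃ H K : Matrix (Fin n) (Fin n) ℂ,
      H.IsHermitian ∧ K.IsHermitian ∧ B = H + Complex.I • K :=
    ⟨realPart B, imaginaryPart B, (realPart B).2, (imaginaryPart B).2,
      (realPart_add_I_smul_imaginaryPart B).symm⟩
  have hsymm : (H + Complex.I • K)ᴴ * (H + Complex.I • K) +
      (H + Complex.I • K) * (H + Complex.I • K)ᴴ = (2 : ℂ) • (H * H + K * K) := by
    rw [Matrix.conjTranspose_add, Matrix.conjTranspose_smul, hH.eq, hK.eq]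
    simp only [Matrix.mul_add, Matrix.add_mul, Matrix.smul_mul, Matrix.mul_smul, smul_add,
      smul_smul, Complex.star_def, Complex.conj_I, mul_neg, neg_mul, smul_neg, Complex.I_mul_I,
      neg_neg, one_smul, neg_smul, two_smul]
    abel
  have hfrob : frobSq (H + Complex.I • K) = frobSq H + frobSq K := by
    have htr := congrArg (fun M => (Matrix.trace M).re) hsymm
    simp only [Matrix.trace_add, Matrix.trace_mul_comm (H + Complex.I • K), Matrix.trace_smul,
      smul_eq_mul, Complex.add_re, Complex.re_ofNat, Complex.im_ofNat, Complex.mul_re] at htr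
    simp only [frobSq, hH.eq, hK.eq]
    linarith
  have hreal : ∀ M : Matrix (Fin n) (Fin n) ℂ, M.IsHermitian → (Matrix.trace (D * M)).im = 0 := by
    intro M hM
    rw [← Complex.conj_eq_iff_im, ← Complex.star_def, ← Matrix.trace_conjTranspose,
      Matrix.conjTranspose_mul, hM.eq, hDpos.1.eq, Matrix.trace_mul_comm]
  have hnorm : ‖Matrix.trace (D * (H + Complex.I • K))‖ ^ 2 =
      (Matrix.trace (D * H)).re ^ 2 + (Matrix.trace (D * K)).re ^ 2 := by
    rw [Matrix.mul_add, Matrix.trace_add, Matrix.mul_smul, Matrix.trace_smul,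
      ← Complex.normSq_eq_norm_sq, Complex.normSq_apply]
    simp [hreal H hH, hreal K hK, pow_two]
  have htrace : (Matrix.trace (D * ((2 : ℂ) • (H * H + K * K)))).re =
      2 * ((Matrix.trace (D * (H * H))).re + (Matrix.trace (D * (K * K))).re) := by
    simp [Matrix.mul_add]
    ring
  have hmain := frobSq_commutator_le_variance A (H + Complex.I • K)
  rw [← hD, hsymm, htrace, hnorm] at hmain
  have hvH := variance_le_of_isHermitian hDpos hH
  have hvK := variance_le_of_isHermitian hDpos hK
  rw [hDtr] at hvH hvK
  rw [hfrob]
  refine le_of_mul_le_mul_left ?_ hA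
  linarith
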